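/- Let n ≥ 4 be an even integer, and for each natural number L let a(L) denote the (finite) number of fully commutative involutions of Coxeter length L in the affine Coxeter group of type Ã_{n-1}. Then the sequence (a(L)) is periodic with period dividing n from length 1 + n²/4 onwards: a(L + n) = a(L) for every L ≥ 1 + n²/4. -/

import Mathlib

open CoxeterSystem

/-- A single commutation move: transposition of two adjacent letters `a`, `b`
with `M a b = 2`. -/
def CommMove {B : Type*} (M : CoxeterMatrix B) (w w' : List B) : Prop :=
  ∃ (u v : List B) (a b : B), M a b = 2 ∧ w = u ++ a :: b :: v ∧ w' = u ++ b :: a :: v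

/-- Commutation equivalence of words: two words are commutation-equivalent if one can be
obtained from the other by a sequence of transpositions of adjacent commuting letters. -/
def CommEquiv {B : Type*} (M : CoxeterMatrix B) : List B → List B → Prop :=
  Relation.EqvGen (CommMove M)

/-- An element is fully commutative if all its reduced words are commutation-equivalent. -/
def IsFullyCommutative {B W : Type*} [Group W] {M : CoxeterMatrix B}
    (cs : CoxeterSystem M W) (w : W) : Prop :=
  ∀ u v : List B, cs.IsReduced u → cs.wordProd u = w →
    cs.IsReduced v → cs.wordProd v = w → CommEquiv M u v

/-- A fully commutative involution (the identity is allowed). -/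
def IsFCInvolution {B W : Type*} [Group W] {M : CoxeterMatrix B}
    (cs : CoxeterSystem M W) (w : W) : Prop :=
  IsFullyCommutative cs w ∧ w * w = 1

/-- The Coxeter matrix of affine type `Ã_{n-1}` (for `n ≥ 3`): generators
`s_0, …, s_{n-1}` (index `k : Fin n` corresponds to `s_k`), with `m(s_i, s_j) = 3`
if `i - j ≡ ±1 (mod n)` and `m(s_i, s_j) = 2` otherwise (for `i ≠ j`). -/
def affineA (n : ℕ) : CoxeterMatrix (Fin n) where
  M := Matrix.of fun i j : Fin n =>
    if (i : ℕ) = (j : ℕ) then 1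
    else if (i : ℕ) + 1 = (j : ℕ) ∨ (j : ℕ) + 1 = (i : ℕ)
        ∨ ((i : ℕ) = 0 ∧ (j : ℕ) + 1 = n) ∨ ((j : ℕ) = 0 ∧ (i : ℕ) + 1 = n) then 3
    else 2
  isSymm := by
    ext i j
    simp only [Matrix.transpose_apply, Matrix.of_apply]
    split_ifs <;> omega
  diagonal := by intro i; simp [Matrix.of_apply]
  off_diagonal := by
    intro i j hij
    have h : (i : ℕ) ≠ (j : ℕ) := fun h => hij (Fin.ext h)
    simp only [Matrix.of_apply]
    split_ifs <;> omega

section Words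

variable {B : Type*} {M : CoxeterMatrix B} {u v w : List B}

namespace CommEquiv

theorem refl (u : List B) : CommEquiv M u u := Relation.EqvGen.refl u

theorem symm (h : CommEquiv M u v) : CommEquiv M v u := Relation.EqvGen.symm _ _ h

theorem trans (h : CommEquiv M u v) (h' : CommEquiv M v w) : CommEquiv M u w :=
  Relation.EqvGen.trans _ _ _ h h'

theorem map_of_commMove {α : Type*} {f : List B → α}
    (hf : ∀ u v, CommMove M u v → f u = f v) (h : CommEquiv M u v) : f u = f v := by
  induction h with
  | rel _ _ h => exact hf _ _ h
  | refl => rfl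
  | symm _ _ _ ih => exact ih.symm
  | trans _ _ _ _ _ ih ih' => exact ih.trans ih'

theorem append_left (x : List B) (h : CommEquiv M u v) : CommEquiv M (x ++ u) (x ++ v) := by
  induction h with
  | rel _ _ h =>
    obtain ⟨p, q, a, b, hab, rfl, rfl⟩ := h
    exact Relation.EqvGen.rel _ _ ⟨x ++ p, q, a, b, hab, by simp, by simp⟩
  | refl => exact refl _
  | symm _ _ _ ih => exact ih.symm
  | trans _ _ _ _ _ ih ih' => exact ih.trans ih'

theorem cons (a : B) (h : CommEquiv M u v) : CommEquiv M (a :: u) (a :: v) :=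
  h.append_left [a]

theorem swap {a b : B} (hab : M a b = 2) (u : List B) :
    CommEquiv M (a :: b :: u) (b :: a :: u) :=
  Relation.EqvGen.rel _ _ ⟨[], u, a, b, hab, rfl, rfl⟩

theorem move_front {a : B} (y z : List B) (h : ∀ b ∈ y, M b a = 2) :
    CommEquiv M (y ++ a :: z) (a :: (y ++ z)) := by
  induction y with
  | nil => exact refl _
  | cons b y ih =>
    exact ((ih fun c hc => h c (by simp [hc])).cons b).trans (swap (h b (by simp)) _)

theorem length_eq (h : CommEquiv M u v) : u.length = v.length := by
  refine map_of_commMove (f := List.length) ?_ h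
  rintro _ _ ⟨p, q, a, b, -, rfl, rfl⟩
  simp

theorem wordProd_eq {W : Type*} [Group W] (cs : CoxeterSystem M W) (h : CommEquiv M u v) :
    cs.wordProd u = cs.wordProd v := by
  refine map_of_commMove (f := cs.wordProd) ?_ h
  rintro _ _ ⟨p, q, a, b, hab, rfl, rfl⟩
  have h1 := cs.simple_mul_simple_pow a b
  rw [hab, pow_two] at h1
  have h2 : cs.simple a * cs.simple b = cs.simple b * cs.simple a := by
    rw [mul_eq_one_iff_eq_inv.1 h1, mul_inv_rev, cs.inv_simple, cs.inv_simple]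
  simp only [cs.wordProd_append, cs.wordProd_cons]
  rw [← mul_assoc (cs.simple a), h2, mul_assoc]

end CommEquiv

/-- The subword formed by the letters `i` and `j`. -/
def pairFilter [DecidableEq B] (i j : B) (u : List B) : List B :=
  u.filter fun x => x = i ∨ x = j

variable [DecidableEq B]

@[simp] theorem pairFilter_nil (i j : B) : pairFilter i j [] = [] := rfl

theorem pairFilter_cons (i j a : B) (u : List B) :
    pairFilter i j (a :: u) = if a = i ∨ a = j then a :: pairFilter i j u else pairFilter i j u := by
  simp [pairFilter, List.filter_cons]

@[simp] theorem pairFilter_append (i j : B) (u v : List B) :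
    pairFilter i j (u ++ v) = pairFilter i j u ++ pairFilter i j v := by
  simp [pairFilter]

theorem pairFilter_comm (i j : B) (u : List B) : pairFilter i j u = pairFilter j i u := by
  simp [pairFilter, or_comm]

theorem pairFilter_eq_nil {i j : B} (hi : i ∉ u) (hj : j ∉ u) : pairFilter i j u = [] := by
  simp only [pairFilter, List.filter_eq_nil_iff]
  rintro a ha h
  simp only [decide_eq_true_eq] at h
  rcases h with rfl | rfl <;> contradiction

theorem mem_pairFilter {i j a : B} : a ∈ pairFilter i j u ↔ a ∈ u ∧ (a = i ∨ a = j) := by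
  simp [pairFilter]

theorem count_pairFilter_left (i j : B) (u : List B) : (pairFilter i j u).count i = u.count i := by
  rw [pairFilter, List.count_filter]; simp

theorem count_pairFilter_right (i j : B) (u : List B) :
    (pairFilter i j u).count j = u.count j := by
  rw [pairFilter, List.count_filter]; simp

theorem CommEquiv.pairFilter_eq (h : CommEquiv M u v) {i j : B} (hij : M i j ≠ 2) :
    pairFilter i j u = pairFilter i j v := by
  refine map_of_commMove (f := pairFilter i j) ?_ h
  rintro _ _ ⟨p, q, a, b, hab, rfl, rfl⟩
  have hab' : a ≠ b := by rintro rfl; simp at hab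
  have : ¬ ((a = i ∨ a = j) ∧ (b = i ∨ b = j)) := by
    rintro ⟨rfl | rfl, rfl | rfl⟩ <;> first | exact hab' rfl | exact hij hab | skip
    exact hij (M.symmetric .. ▸ hab)
  simp only [pairFilter_append, pairFilter_cons]
  split_ifs <;> first | rfl | (exfalso; tauto)

theorem CommEquiv.count_eq (h : CommEquiv M u v) (i : B) : u.count i = v.count i := by
  rw [← count_pairFilter_left i i u, h.pairFilter_eq (by simp), count_pairFilter_left]

/-- Words having the same projection to each pair of non-commuting letters are
commutation-equivalent. -/
theorem commEquiv_of_pairFilter_eq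
    (h : ∀ i j, M i j ≠ 2 → pairFilter i j u = pairFilter i j v) : CommEquiv M u v := by
  induction u generalizing v with
  | nil =>
    cases v with
    | nil => exact .refl _
    | cons b v => simpa [pairFilter_cons] using h b b (by simp)
  | cons a u ih =>
    have ha : a ∈ v := by
      have : a ∈ pairFilter a a v := by rw [← h a a (by simp)]; simp [pairFilter_cons]
      exact (mem_pairFilter.1 this).1
    obtain ⟨y, z, rfl, hay⟩ := List.eq_append_cons_of_mem ha
    have hy : ∀ b ∈ y, M b a = 2 := by
      intro b hb
      by_contra hba
      have h1 := h b a hba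
      have h2 : pairFilter b a y ≠ [] :=
        List.ne_nil_of_mem (mem_pairFilter.2 ⟨hb, Or.inl rfl⟩)
      obtain ⟨c, l, hl⟩ := List.exists_cons_of_ne_nil h2
      have h3 : c ∈ pairFilter b a y := by rw [hl]; simp
      rw [pairFilter_append, hl, pairFilter_cons] at h1
      simp only [or_true, if_true, List.cons_append, List.cons.injEq] at h1
      rw [← h1.1, mem_pairFilter] at h3
      exact hay h3.1
    have hmove := CommEquiv.move_front y z hy
    refine ((ih fun i j hij => ?_).cons a).trans hmove.symm
    have h1 := (h i j hij).trans (hmove.pairFilter_eq hij)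
    simp only [pairFilter_cons] at h1
    split_ifs at h1
    · simpa using h1
    · exact h1

/-- A word is alternating if the occurrences of any two letters `i`, `j` with `m(i, j) = 3`
alternate. -/
def Alternating (M : CoxeterMatrix B) (u : List B) : Prop :=
  ∀ i j, M i j = 3 → (pairFilter i j u).IsChain (· ≠ ·)

namespace Alternating

theorem congr (hu : Alternating M u) (h : CommEquiv M u v) : Alternating M v := fun i j hij => by
  rw [← h.pairFilter_eq (by omega)]; exact hu i j hij

theorem tail {a : B} (hu : Alternating M (a :: u)) : Alternating M u := fun i j hij => by
  have := hu i j hij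
  rw [pairFilter_cons] at this
  split_ifs at this
  · exact this.tail
  · exact this

end Alternating

/-- The letter `t` can be moved to the front of `u` by commutation moves. -/
def IsInitial (M : CoxeterMatrix B) (t : B) (u : List B) : Prop :=
  ∃ z, CommEquiv M u (t :: z)

end Words

section Lists

variable {α : Type*}

theorem List.IsChain.eq_of_head_eq {a b : α} :
    ∀ {l l' : List α}, l.IsChain (· ≠ ·) → l'.IsChain (· ≠ ·) → (∀ x ∈ l, x = a ∨ x = b) →
      (∀ x ∈ l', x = a ∨ x = b) → l.length = l'.length → l.head? = l'.head? → l = l'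
  | [], [], _, _, _, _, _, _ => rfl
  | [], _ :: _, _, _, _, _, h, _ => by simp at h
  | _ :: _, [], _, _, _, _, h, _ => by simp at h
  | [x], [y], _, _, _, _, _, h => by simpa using h
  | [x], _ :: _ :: _, _, _, _, _, h, _ => by simp at h
  | _ :: _ :: _, [x], _, _, _, _, h, _ => by simp at h
  | x :: x' :: l, y :: y' :: l', hl, hl', h, h', hlen, hhead => by
    obtain rfl : x = y := by simpa using hhead
    have hx := List.isChain_cons_cons.1 hl
    have hy := List.isChain_cons_cons.1 hl'
    have h1 := h x (by simp)
    have h2 := h x' (by simp)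
    have h3 := h' y' (by simp)
    have : x' = y' := by
      have := hx.1; have := hy.1
      grind
    subst this
    rw [List.IsChain.eq_of_head_eq hx.2 hy.2 (fun z hz => h z (List.mem_cons_of_mem _ hz))
      (fun z hz => h' z (List.mem_cons_of_mem _ hz)) (by simpa using hlen) rfl]

variable [DecidableEq α]

theorem List.IsChain.count_le_count_succ {a b : α} (hab : a ≠ b) :
    ∀ {l : List α}, l.IsChain (· ≠ ·) → (∀ x ∈ l, x = a ∨ x = b) →
      (l.head? = some b → l.count a ≤ l.count b) ∧ l.count a ≤ l.count b + 1
  | [], _, _ => by simp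
  | x :: l, hl, h => by
    have ih := List.IsChain.count_le_count_succ hab hl.tail
      (fun z hz => h z (List.mem_cons_of_mem _ hz))
    rw [List.tail_cons] at ih
    rcases h x (by simp) with rfl | rfl
    · have h2 : l.count x ≤ l.count b := by
        cases l with
        | nil => simp
        | cons y l =>
          refine ih.1 ?_
          have := (List.isChain_cons_cons.1 hl).1
          have := h y (by simp)
          simp; grind
      simp [hab]; omega
    · have := ih.2
      simp [hab.symm]; omega

theorem List.IsChain.head?_eq {a b : α} (hab : a ≠ b) {l : List α}
    (hl : l.IsChain (· ≠ ·)) (h : ∀ x ∈ l, x = a ∨ x = b) (hc : l.count b < l.count a) :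
    l.head? = some a := by
  have h1 := (hl.count_le_count_succ hab h).1
  cases l with
  | nil => simp at hc
  | cons x l =>
    rcases h x (by simp) with rfl | rfl
    · rfl
    · have := h1 rfl; omega

theorem List.length_eq_count_add_count {a b : α} (hab : a ≠ b) {l : List α}
    (h : ∀ x ∈ l, x = a ∨ x = b) : l.length = l.count a + l.count b := by
  induction l with
  | nil => rfl
  | cons x l ih =>
    have := ih fun z hz => h z (List.mem_cons_of_mem _ hz)
    rcases h x (by simp) with rfl | rfl
    · simp [hab]; omega
    · simp [hab.symm]; omega

/-- An alternating word in two letters with more occurrences of `a` is determined by the number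
of occurrences of each letter. -/
theorem List.IsChain.eq_of_count_eq {a b : α} (hab : a ≠ b) {l l' : List α}
    (hl : l.IsChain (· ≠ ·)) (hl' : l'.IsChain (· ≠ ·)) (h : ∀ x ∈ l, x = a ∨ x = b)
    (h' : ∀ x ∈ l', x = a ∨ x = b) (hc : l.count b < l.count a)
    (ha : l.count a = l'.count a) (hb : l.count b = l'.count b) : l = l' := by
  refine hl.eq_of_head_eq hl' h h' ?_ ?_
  · rw [List.length_eq_count_add_count hab h, List.length_eq_count_add_count hab h', ha, hb]
  · rw [hl.head?_eq hab h hc, hl'.head?_eq hab h' (by omega)]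

theorem List.IsChain.count_ne_of_palindrome {a b : α} (hab : a ≠ b) {l : List α}
    (hl : l.IsChain (· ≠ ·)) (h : ∀ x ∈ l, x = a ∨ x = b) (hp : l.reverse = l) (hne : l ≠ []) :
    l.count a ≠ l.count b := by
  intro hc
  have hlen := List.length_eq_count_add_count hab h
  have hpos := List.length_pos_iff.2 hne
  have hk : l.count a - 1 + 1 < l.length := by omega
  have hchain := List.isChain_iff_getElem.1 hl (l.count a - 1) hk
  have h1 : l.reverse[l.count a - 1]? = l[l.count a - 1]? := by rw [hp]
  rw [List.getElem?_reverse (by omega),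
    show l.length - 1 - (l.count a - 1) = l.count a - 1 + 1 by omega,
    List.getElem?_eq_getElem hk, List.getElem?_eq_getElem (by omega)] at h1
  exact hchain (Option.some.inj h1).symm

end Lists

section AffineStep

variable {R : Type*} [CommRing R] [DecidableEq R]

/-- The involution of `ℤ` swapping `x` and `x + 1` for all integers `x` with image `i` in `R`. -/
def affineStep (i : R) (x : ℤ) : ℤ :=
  if (x : R) = i then x + 1 else if (x : R) = i + 1 then x - 1 else x

theorem affineStep_of_eq {i : R} {x : ℤ} (h : (x : R) = i) : affineStep i x = x + 1 := by
  simp [affineStep, h]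

theorem affineStep_of_eq_add_one (h1 : (1 : R) ≠ 0) {i : R} {x : ℤ} (h : (x : R) = i + 1) :
    affineStep i x = x - 1 := by
  simp [affineStep, h, h1]

theorem affineStep_of_ne {i : R} {x : ℤ} (h : (x : R) ≠ i) (h' : (x : R) ≠ i + 1) :
    affineStep i x = x := by
  simp [affineStep, h, h']

theorem affineStep_involutive (h1 : (1 : R) ≠ 0) (i : R) :
    Function.Involutive (affineStep i) := by
  intro x
  by_cases hx : (x : R) = i
  · simp [affineStep, hx, h1]
  by_cases hx' : (x : R) = i + 1
  · simp [affineStep, hx', h1]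
  · rw [affineStep_of_ne hx hx', affineStep_of_ne hx hx']

theorem affineStep_comm (h1 : (1 : R) ≠ 0) {i j : R} (h : i ≠ j) (hij : j ≠ i + 1)
    (hji : i ≠ j + 1) (x : ℤ) :
    affineStep i (affineStep j x) = affineStep j (affineStep i x) := by
  by_cases h₁ : (x : R) = i
  · simp [affineStep, h₁, h, hij.symm, hji]
  by_cases h₂ : (x : R) = i + 1
  · simp [affineStep, h₂, h1, h, hij.symm, hji]
  by_cases h₃ : (x : R) = j
  · simp [affineStep, h₃, h.symm, hij, hji.symm]
  by_cases h₄ : (x : R) = j + 1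
  · simp [affineStep, h₄, h1, h.symm, hij, hji.symm]
  · simp [affineStep, h₁, h₂, h₃, h₄]

theorem affineStep_braid (h1 : (1 : R) ≠ 0) (h2 : (2 : R) ≠ 0) (i : R) (x : ℤ) :
    affineStep i (affineStep (i + 1) (affineStep i x)) =
      affineStep (i + 1) (affineStep i (affineStep (i + 1) x)) := by
  have e1 : i + 1 + 1 ≠ i := by rwa [add_assoc, Ne, add_eq_left, one_add_one_eq_two]
  have e2 : i + 1 + 1 ≠ i + 1 := by rwa [Ne, add_eq_left]
  have e3 : i + 1 ≠ i := by rwa [Ne, add_eq_left]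
  by_cases h₁ : (x : R) = i
  · have e4 : ((x + 1 : ℤ) : R) = i + 1 := by simp [h₁]
    have e5 : ((x + 1 + 1 : ℤ) : R) = i + 1 + 1 := by simp [h₁]
    rw [affineStep_of_ne (i := i + 1) (x := x) (by rw [h₁]; exact e3.symm) (by rw [h₁]; exact e1.symm),
      affineStep_of_eq h₁, affineStep_of_eq e4,
      affineStep_of_ne (by rw [e5]; exact e1) (by rw [e5]; exact e2)]
  by_cases h₂ : (x : R) = i + 1
  · simp [affineStep, h₂, h1, e1, e1.symm]
  by_cases h₃ : (x : R) = i + 1 + 1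
  · have e4 : ((x - 1 : ℤ) : R) = i + 1 := by simp [h₃]
    have e5 : ((x - 1 - 1 : ℤ) : R) = i := by simp [h₃]
    rw [affineStep_of_ne h₁ h₂, affineStep_of_eq_add_one h1 h₃, affineStep_of_eq_add_one h1 e4,
      affineStep_of_ne (i := i + 1) (by rw [e5]; exact e3.symm) (by rw [e5]; exact e1.symm)]
  · simp [affineStep, h₁, h₂, h₃]

theorem affineStep_lt (h1 : (1 : R) ≠ 0) (i : R) {x y : ℤ} (hxy : x < y)
    (h : ¬ ((x : R) = i ∧ y = x + 1)) : affineStep i x < affineStep i y := by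
  refine lt_of_le_of_ne ?_ ((affineStep_involutive h1 i).injective.ne hxy.ne)
  unfold affineStep
  split_ifs with hx hy hy' <;> try omega
  have h₁ : y ≠ x + 1 := fun hy => h ⟨hx, hy⟩
  have h₂ : y ≠ x + 1 + 1 := by
    rintro rfl
    rw [Int.cast_add, Int.cast_add, hx] at hy'
    simp [h1] at hy'
  omega

theorem affineStep_add_mul {n : ℕ} [CharP R n] (i : R) (x k : ℤ) :
    affineStep i (x + n * k) = affineStep i x + n * k := by
  unfold affineStep
  simp only [Int.cast_add, Int.cast_mul, Int.cast_natCast, CharP.cast_eq_zero, zero_mul, add_zero]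
  split_ifs <;> ring

end AffineStep

section Affine

open scoped Fin.CommRing

variable {n : ℕ}

theorem Fin.natCast_ne_zero_of_lt [NeZero n] {k : ℕ} (hk : 0 < k) (hkn : k < n) :
    (k : Fin n) ≠ 0 := by
  rw [Ne, CharP.cast_eq_zero_iff (Fin n) n]
  exact fun h => absurd (Nat.le_of_dvd hk h) (by omega)

theorem Fin.exists_add_mul_of_intCast_eq [NeZero n] {x y : ℤ} (h : (x : Fin n) = y) : ∃ k : ℤ, y = x + n * k := by
  rw [CharP.intCast_eq_intCast (Fin n) n, Int.modEq_iff_dvd] at h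
  obtain ⟨k, hk⟩ := h
  exact ⟨k, by omega⟩

variable [Fact (4 ≤ n)] [NeZero n]

theorem Fin.one_ne_zero_of_four_le : (1 : Fin n) ≠ 0 := by
  have := Fact.out (p := 4 ≤ n)
  simpa using Fin.natCast_ne_zero_of_lt (n := n) (k := 1) (by omega) (by omega)

theorem Fin.two_ne_zero_of_four_le : (2 : Fin n) ≠ 0 := by
  have := Fact.out (p := 4 ≤ n)
  simpa using Fin.natCast_ne_zero_of_lt (n := n) (k := 2) (by omega) (by omega)

theorem Fin.eq_add_one_iff_val (i j : Fin n) :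
    j = i + 1 ↔ (i : ℕ) + 1 = j ∨ ((j : ℕ) = 0 ∧ (i : ℕ) + 1 = n) := by
  have hn := Fact.out (p := 4 ≤ n)
  have h1 : ((1 : Fin n) : ℕ) = 1 := by
    obtain ⟨k, rfl⟩ := Nat.exists_eq_add_of_le' hn
    rfl
  rw [Fin.ext_iff, Fin.val_add, h1]
  have hi := i.isLt
  have hj := j.isLt
  rcases Nat.lt_or_ge ((i : ℕ) + 1) n with h | h
  · rw [Nat.mod_eq_of_lt h]; omega
  · rw [show (i : ℕ) + 1 = n by omega, Nat.mod_self]; omega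

theorem affineA_apply (i j : Fin n) :
    affineA n i j = if i = j then 1 else if j = i + 1 ∨ i = j + 1 then 3 else 2 := by
  change (if (i : ℕ) = (j : ℕ) then 1 else _) = _
  refine if_congr Fin.ext_iff.symm rfl (if_congr ?_ rfl rfl)
  rw [Fin.eq_add_one_iff_val i j, Fin.eq_add_one_iff_val j i]
  tauto

theorem affineA_eq_three_iff {i j : Fin n} :
    affineA n i j = 3 ↔ j = i + 1 ∨ i = j + 1 := by
  rw [affineA_apply]
  have h1 := Fin.one_ne_zero_of_four_le (n := n)
  by_cases hij : i = j
  · subst hij; simp [h1]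
  · rw [if_neg hij]; split_ifs <;> simp_all

theorem affineA_eq_two_iff {i j : Fin n} :
    affineA n i j = 2 ↔ i ≠ j ∧ j ≠ i + 1 ∧ i ≠ j + 1 := by
  rw [affineA_apply]
  by_cases hij : i = j
  · simp [hij]
  · rw [if_neg hij]; split_ifs <;> simp_all; tauto

theorem affineA_eq_one_or_two_or_three (i j : Fin n) :
    i = j ∨ affineA n i j = 2 ∨ affineA n i j = 3 := by
  rw [affineA_apply]
  split_ifs <;> simp_all

/-- The permutation of `ℤ` by which the generator `s_i` acts. -/
def affinePerm (i : Fin n) : Equiv.Perm ℤ :=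
  (affineStep_involutive Fin.one_ne_zero_of_four_le i).toPerm

theorem affinePerm_mul_self (i : Fin n) : affinePerm i * affinePerm i = 1 :=
  Equiv.ext (affineStep_involutive Fin.one_ne_zero_of_four_le i)

theorem affinePerm_inv (i : Fin n) : (affinePerm i)⁻¹ = affinePerm i :=
  inv_eq_of_mul_eq_one_left (affinePerm_mul_self i)

theorem affinePerm_braid (i : Fin n) :
    affinePerm i * affinePerm (i + 1) * affinePerm i =
      affinePerm (i + 1) * affinePerm i * affinePerm (i + 1) :=
  Equiv.ext (affineStep_braid Fin.one_ne_zero_of_four_le Fin.two_ne_zero_of_four_le i)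

theorem affinePerm_isLiftable : (affineA n).IsLiftable (affinePerm (n := n)) := by
  intro i j
  have h1 := Fin.one_ne_zero_of_four_le (n := n)
  rcases affineA_eq_one_or_two_or_three i j with rfl | h | h
  · simp [affinePerm_mul_self]
  · rw [h, pow_two]
    have hc : affinePerm i * affinePerm j = affinePerm j * affinePerm i := by
      obtain ⟨h2, h3, h4⟩ := affineA_eq_two_iff.1 h
      exact Equiv.ext (affineStep_comm h1 h2 h3 h4)
    rw [mul_eq_one_iff_eq_inv, mul_inv_rev, affinePerm_inv, affinePerm_inv, hc]
  · have hb : affinePerm i * affinePerm j * affinePerm i =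
        affinePerm j * affinePerm i * affinePerm j := by
      rcases affineA_eq_three_iff.1 h with rfl | rfl
      · exact affinePerm_braid i
      · exact (affinePerm_braid j).symm
    have h3 : (affinePerm i * affinePerm j) ^ 3 = (affinePerm i * affinePerm j * affinePerm i) *
        (affinePerm j * affinePerm i * affinePerm j) := by
      simp only [pow_succ, pow_zero, one_mul, mul_assoc]
    rw [h, h3, ← hb, mul_eq_one_iff_eq_inv]
    simp only [mul_inv_rev, affinePerm_inv, mul_assoc]

/-- The action of a word on `ℤ`. -/
def wordPerm (u : List (Fin n)) : Equiv.Perm ℤ := (u.map affinePerm).prod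

theorem wordPerm_cons (a : Fin n) (u : List (Fin n)) :
    wordPerm (a :: u) = affinePerm a * wordPerm u := by
  simp [wordPerm]

theorem wordPerm_append (u v : List (Fin n)) : wordPerm (u ++ v) = wordPerm u * wordPerm v := by
  simp [wordPerm]

theorem wordPerm_cons_inv (a : Fin n) (u : List (Fin n)) (x : ℤ) :
    (wordPerm (a :: u))⁻¹ x = (wordPerm u)⁻¹ (affineStep a x) := by
  rw [wordPerm_cons, mul_inv_rev, affinePerm_inv]; rfl

theorem wordPerm_eq_of_wordProd_eq {u v : List (Fin n)}
    (h : (affineA n).toCoxeterSystem.wordProd u = (affineA n).toCoxeterSystem.wordProd v) :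
    wordPerm u = wordPerm v := by
  have key : ∀ w, wordPerm w = (affineA n).toCoxeterSystem.lift
      ⟨affinePerm, affinePerm_isLiftable⟩ ((affineA n).toCoxeterSystem.wordProd w) := by
    intro w
    induction w with
    | nil => simp [wordPerm]
    | cons a w ih =>
      rw [wordPerm_cons, CoxeterSystem.wordProd_cons, map_mul, ih,
        CoxeterSystem.lift_apply_simple]
  rw [key, key, h]

theorem CommEquiv.wordPerm_eq {u v : List (Fin n)} (h : CommEquiv (affineA n) u v) :
    wordPerm u = wordPerm v :=
  wordPerm_eq_of_wordProd_eq (h.wordProd_eq _)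

theorem wordPerm_add_mul (u : List (Fin n)) (x k : ℤ) :
    wordPerm u (x + n * k) = wordPerm u x + n * k := by
  induction u with
  | nil => simp [wordPerm]
  | cons a u ih =>
    rw [wordPerm_cons, Equiv.Perm.mul_apply, ih]
    exact affineStep_add_mul a _ k

end Affine

section Reduced

open scoped Fin.CommRing

namespace Alternating

variable {B : Type*} [DecidableEq B] {M : CoxeterMatrix B}

theorem not_cons_cons {a b : B} (hab : M a b = 3) {z : List B} :
    ¬ Alternating M (a :: a :: z) := fun h => by
  have := h a b hab
  simp [pairFilter_cons] at this

theorem not_isInitial_of_cons {a b : B} (hab : M a b = 3) {u : List B}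
    (h : Alternating M (a :: u)) : ¬ IsInitial M a u := fun ⟨_, hz⟩ =>
  not_cons_cons hab (h.congr (hz.cons a))

theorem not_isInitial_of_cons_cons {a b c : B} (hac : M a c = 3) (hba : b ≠ a) (hbc : b ≠ c)
    {u : List B} (h : Alternating M (a :: b :: u)) : ¬ IsInitial M a u := fun ⟨z, hz⟩ => by
  have h1 := h.congr ((hz.cons b).cons a) a c hac
  simp [pairFilter_cons, hba, hbc] at h1

end Alternating

variable {n : ℕ} [Fact (4 ≤ n)] [NeZero n]

theorem affineA_add_one (i : Fin n) : affineA n i (i + 1) = 3 :=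
  affineA_eq_three_iff.2 (Or.inl rfl)

theorem affineA_sub_one (i : Fin n) : affineA n i (i - 1) = 3 :=
  affineA_eq_three_iff.2 (Or.inr (by simp))

theorem Alternating.not_isInitial_tail {a : Fin n} {u : List (Fin n)}
    (h : Alternating (affineA n) (a :: u)) : ¬ IsInitial (affineA n) a u :=
  h.not_isInitial_of_cons (affineA_add_one a)

theorem Fin.add_one_ne_sub_one (i : Fin n) : i + 1 ≠ i - 1 := by
  rw [Ne, eq_sub_iff_add_eq, add_assoc, add_eq_left, one_add_one_eq_two]
  exact Fin.two_ne_zero_of_four_le (n := n)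

theorem Fin.add_one_ne_self (i : Fin n) : i + 1 ≠ i := by
  simpa using Fin.one_ne_zero_of_four_le (n := n)

theorem Alternating.not_isInitial_tail_tail {a b : Fin n} (hab : affineA n a b = 3)
    {u : List (Fin n)} (h : Alternating (affineA n) (a :: b :: u)) :
    ¬ IsInitial (affineA n) a u := by
  rcases affineA_eq_three_iff.1 hab with rfl | rfl
  · exact h.not_isInitial_of_cons_cons (affineA_sub_one a) (Fin.add_one_ne_self a)
      (Fin.add_one_ne_sub_one a)
  · refine h.not_isInitial_of_cons_cons (affineA_add_one _) (Fin.add_one_ne_self b).symm ?_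
    intro hb
    have := Fin.two_ne_zero_of_four_le (n := n)
    rw [add_assoc, left_eq_add, one_add_one_eq_two] at hb
    exact this hb

theorem affineStep_apply_pair_left {a : Fin n} {x : ℤ} (hx : (x : Fin n) = a + 1) :
    affineStep a x = x - 1 ∧ affineStep a (x + 1) = x + 1 := by
  have h1 := Fin.one_ne_zero_of_four_le (n := n)
  have h2 := Fin.two_ne_zero_of_four_le (n := n)
  refine ⟨affineStep_of_eq_add_one h1 hx, affineStep_of_ne ?_ ?_⟩
  · simpa [hx, add_assoc, one_add_one_eq_two] using h2
  · simpa [hx] using h1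

theorem affineStep_apply_pair_right {t : Fin n} {x : ℤ} (hx : (x : Fin n) = t) :
    affineStep (t + 1) x = x ∧ affineStep (t + 1) (x + 1) = x + 1 + 1 := by
  have h1 := Fin.one_ne_zero_of_four_le (n := n)
  have h2 := Fin.two_ne_zero_of_four_le (n := n)
  refine ⟨affineStep_of_ne ?_ ?_, affineStep_of_eq (by simp [hx])⟩
  · simpa [hx] using h1
  · simpa [hx, add_assoc, one_add_one_eq_two] using h2

/-- If `t` is not an initial letter of an alternating word, then the inverse of the associated
permutation preserves the order of `x` and `x + 1` for all `x ≡ t`. -/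
theorem wordPerm_inv_lt : ∀ (u : List (Fin n)), Alternating (affineA n) u →
    ∀ t, ¬ IsInitial (affineA n) t u → ∀ x : ℤ, (x : Fin n) = t →
      (wordPerm u)⁻¹ x < (wordPerm u)⁻¹ (x + 1)
  | [], _, _, _, x, _ => by simp [wordPerm]
  | a :: u, hu, t, ht, x, hx => by
    have h1 := Fin.one_ne_zero_of_four_le (n := n)
    have h2 := Fin.two_ne_zero_of_four_le (n := n)
    have hat : a ≠ t := by rintro rfl; exact ht ⟨u, .refl _⟩
    have hau := hu.not_isInitial_tail
    have key : ∀ y : ℤ, (y : Fin n) = a →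
      (wordPerm u)⁻¹ y < (wordPerm u)⁻¹ (y + 1) := wordPerm_inv_lt u hu.tail a hau
    rw [wordPerm_cons_inv, wordPerm_cons_inv]
    rcases affineA_eq_one_or_two_or_three a t with h | h | h
    · exact absurd h hat
    · have ht' : ¬ IsInitial (affineA n) t u := fun ⟨z, hz⟩ =>
        ht ⟨a :: z, (hz.cons a).trans (.swap h z)⟩
      obtain ⟨-, h3, h4⟩ := affineA_eq_two_iff.1 h
      rw [affineStep_of_ne (by rw [hx]; exact hat.symm) (by rw [hx]; exact h3),
        affineStep_of_ne (by simp [hx]; exact h4.symm) (by simp [hx, hat.symm])]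
      exact wordPerm_inv_lt u hu.tail t ht' x hx
    · by_cases ht' : IsInitial (affineA n) t u
      · obtain ⟨z, hz⟩ := ht'
        have hz' : Alternating (affineA n) (t :: z) := hu.tail.congr hz
        have hlen : z.length < u.length + 1 := by simp [hz.length_eq]
        have haz : ¬ IsInitial (affineA n) a z :=
          (hu.congr (hz.cons a)).not_isInitial_tail_tail h
        have key' : ∀ y : ℤ, (y : Fin n) = a →
          (wordPerm z)⁻¹ y < (wordPerm z)⁻¹ (y + 1) := wordPerm_inv_lt z hz'.tail a haz
        rw [hz.wordPerm_eq, wordPerm_cons_inv, wordPerm_cons_inv]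
        rcases affineA_eq_three_iff.1 h with rfl | rfl
        · rw [(affineStep_apply_pair_left hx).1, (affineStep_apply_pair_left hx).2,
            affineStep_of_ne (by simpa [hx] using h1) (by simp [hx, add_assoc, one_add_one_eq_two, h2]),
            affineStep_of_eq_add_one h1 (by simp [hx]), add_sub_cancel_right]
          simpa using key' (x - 1) (by simp [hx])
        · rw [(affineStep_apply_pair_right hx).1, (affineStep_apply_pair_right hx).2, affineStep_of_eq hx,
            affineStep_of_ne (by simp [hx, add_assoc, one_add_one_eq_two, h2]) (by simp [hx, h1])]
          exact key' (x + 1) (by simp [hx])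
      · have key' : ∀ y : ℤ, (y : Fin n) = t →
          (wordPerm u)⁻¹ y < (wordPerm u)⁻¹ (y + 1) := wordPerm_inv_lt u hu.tail t ht'
        rcases affineA_eq_three_iff.1 h with rfl | rfl
        · rw [(affineStep_apply_pair_left hx).1, (affineStep_apply_pair_left hx).2]
          have := key (x - 1) (by simp [hx])
          rw [sub_add_cancel] at this
          exact this.trans (key' x hx)
        · rw [(affineStep_apply_pair_right hx).1, (affineStep_apply_pair_right hx).2]
          exact (key' x hx).trans (key (x + 1) (by simp [hx]))
termination_by u => u.length

theorem exists_wordPerm_inv_eq_add_one : ∀ (v : List (Fin n)) (x y : ℤ), x < y →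
    (wordPerm v)⁻¹ y < (wordPerm v)⁻¹ x → ∃ p a q, v = p ++ a :: q ∧
      (((wordPerm p)⁻¹ x : ℤ) : Fin n) = a ∧ (wordPerm p)⁻¹ y = (wordPerm p)⁻¹ x + 1
  | [], x, y, hxy, h => by simp [wordPerm] at h; omega
  | a :: v, x, y, hxy, h => by
    by_cases hx : (x : Fin n) = a ∧ y = x + 1
    · exact ⟨[], a, v, rfl, by simpa [wordPerm] using hx⟩
    · have hlt := affineStep_lt Fin.one_ne_zero_of_four_le a hxy hx
      rw [wordPerm_cons_inv, wordPerm_cons_inv] at h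
      obtain ⟨p, b, q, rfl, h1, h2⟩ := exists_wordPerm_inv_eq_add_one v _ _ hlt h
      exact ⟨a :: p, b, q, rfl, by rwa [wordPerm_cons_inv],
        by rwa [wordPerm_cons_inv, wordPerm_cons_inv]⟩

theorem affinePerm_mul_wordPerm {p : List (Fin n)} {y : ℤ} {a t : Fin n} (hy : (y : Fin n) = a)
    (ht : ((wordPerm p y : ℤ) : Fin n) = t) (h : wordPerm p (y + 1) = wordPerm p y + 1) :
    affinePerm t * wordPerm p = wordPerm p * affinePerm a := by
  have h1 := Fin.one_ne_zero_of_four_le (n := n)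
  ext z
  change affineStep t (wordPerm p z) = wordPerm p (affineStep a z)
  by_cases hz : (z : Fin n) = a
  · obtain ⟨k, rfl⟩ := Fin.exists_add_mul_of_intCast_eq (hy.trans hz.symm)
    rw [affineStep_of_eq hz, affineStep_of_eq (by rw [wordPerm_add_mul]; simpa using ht),
      add_right_comm, wordPerm_add_mul, wordPerm_add_mul, h, add_right_comm]
  by_cases hz' : (z : Fin n) = a + 1
  · have : ((y + 1 : ℤ) : Fin n) = z := by rw [hz', ← hy]; simp
    obtain ⟨k, rfl⟩ := Fin.exists_add_mul_of_intCast_eq this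
    rw [affineStep_of_eq_add_one h1 hz', wordPerm_add_mul, h,
      affineStep_of_eq_add_one h1 (by simp [ht]),
      show y + 1 + n * k - 1 = y + n * k by ring, wordPerm_add_mul]
    ring
  · rw [affineStep_of_ne hz hz', affineStep_of_ne]
    · intro hw
      obtain ⟨k, hk⟩ := Fin.exists_add_mul_of_intCast_eq (ht.trans hw.symm)
      rw [← wordPerm_add_mul, EmbeddingLike.apply_eq_iff_eq] at hk
      exact hz (by simp [hk, hy])
    · intro hw
      have : ((wordPerm p (y + 1) : ℤ) : Fin n) = wordPerm p z := by rw [h, hw]; simp [ht]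
      obtain ⟨k, hk⟩ := Fin.exists_add_mul_of_intCast_eq this
      rw [← wordPerm_add_mul, EmbeddingLike.apply_eq_iff_eq] at hk
      exact hz' (by simp [hk, hy])

/-- The exchange property. -/
theorem exists_wordPerm_cons_eq (v : List (Fin n)) (t : Fin n) (x : ℤ) (hx : (x : Fin n) = t)
    (h : (wordPerm v)⁻¹ (x + 1) < (wordPerm v)⁻¹ x) :
    ∃ v' : List (Fin n), v'.length < v.length ∧ wordPerm v' = wordPerm (t :: v) := by
  obtain ⟨p, a, q, rfl, h1, h2⟩ := exists_wordPerm_inv_eq_add_one v x (x + 1) (by omega) h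
  refine ⟨p ++ q, by simp, ?_⟩
  have h3 : wordPerm p ((wordPerm p)⁻¹ x) = x := by simp
  have h4 : affinePerm t * wordPerm p = wordPerm p * affinePerm a :=
    affinePerm_mul_wordPerm h1 (by rw [h3, hx]) (by rw [← h2]; simp)
  rw [wordPerm_cons, wordPerm_append, wordPerm_append, wordPerm_cons, ← mul_assoc, h4, mul_assoc,
    ← mul_assoc (affinePerm a), affinePerm_mul_self, one_mul]

theorem Alternating.length_le_and_commEquiv (N : ℕ) : ∀ (v u : List (Fin n)), v.length = N →
    Alternating (affineA n) u → wordPerm v = wordPerm u →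
      u.length ≤ v.length ∧ (u.length = v.length → CommEquiv (affineA n) v u) := by
  induction N using Nat.strong_induction_on with
  | _ N ih =>
  rintro (_ | ⟨t, v⟩) u hN hu huv
  · cases u with
    | nil => exact ⟨le_rfl, fun _ => .refl _⟩
    | cons a u =>
      have h1 := Fin.one_ne_zero_of_four_le (n := n)
      have h := wordPerm_inv_lt u hu.tail a hu.not_isInitial_tail ((a : ℕ) : ℤ) (by simp)
      have h2 : ∀ y, (wordPerm u)⁻¹ (affineStep a y) = y := fun y => by
        rw [← wordPerm_cons_inv, ← huv]; simp [wordPerm]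
      have h3 := h2 ((a : ℕ) : ℤ)
      have h4 := h2 (((a : ℕ) : ℤ) + 1)
      rw [affineStep_of_eq (by simp)] at h3
      rw [affineStep_of_eq_add_one h1 (by simp), add_sub_cancel_right] at h4
      omega
  · by_cases ht : IsInitial (affineA n) t u
    · obtain ⟨z, hz⟩ := ht
      have h1 : wordPerm v = wordPerm z := by
        rw [hz.wordPerm_eq, wordPerm_cons, wordPerm_cons] at huv
        exact mul_left_cancel huv
      obtain ⟨h2, h3⟩ := ih v.length (by simp at hN; omega) v z rfl (hu.congr hz).tail h1
      have h4 : u.length = z.length + 1 := by rw [hz.length_eq]; simp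
      refine ⟨by simp; omega, fun h5 => ?_⟩
      exact ((h3 (by simp at h5; omega)).cons t).trans hz.symm
    · have h := wordPerm_inv_lt u hu t ht ((t : ℕ) : ℤ) (by simp)
      have h1 := Fin.one_ne_zero_of_four_le (n := n)
      rw [← huv, wordPerm_cons_inv, wordPerm_cons_inv, affineStep_of_eq (by simp),
        affineStep_of_eq_add_one h1 (by simp), add_sub_cancel_right] at h
      obtain ⟨v', h2, h3⟩ := exists_wordPerm_cons_eq v t _ (by simp) h
      have := (ih v'.length (by simp at hN; omega) v' u rfl hu (h3.trans huv)).1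
      simp only [List.length_cons]
      exact ⟨by omega, fun _ => by omega⟩

end Reduced

section FullyCommutative

open scoped Fin.CommRing

theorem List.exists_of_not_isChain_filter {α : Type*} {p : α → Bool} : ∀ {u : List α},
    ¬ (u.filter p).IsChain (· ≠ ·) →
      ∃ x s y z, u = x ++ s :: (y ++ s :: z) ∧ p s ∧ ∀ b ∈ y, ¬ p b
  | [], h => by simp at h
  | a :: u, h => by
    by_cases hu : (u.filter p).IsChain (· ≠ ·)
    · by_cases ha : p a
      · rw [List.filter_cons_of_pos ha, List.isChain_cons] at h
        have h1 : (u.filter p).head? = some a := by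
          by_contra hne
          exact h ⟨fun y hy => by rintro rfl; exact hne hy, hu⟩
        obtain ⟨l, hl⟩ := List.head?_eq_some_iff.1 h1
        obtain ⟨y, z, rfl, hy, -, -⟩ := List.filter_eq_cons_iff.1 hl
        exact ⟨[], a, y, z, rfl, ha, hy⟩
      · rw [List.filter_cons_of_neg ha] at h
        exact absurd hu h
    · obtain ⟨x, s, y, z, rfl, h1, h2⟩ := List.exists_of_not_isChain_filter hu
      exact ⟨a :: x, s, y, z, rfl, h1, h2⟩

theorem IsFullyCommutative.commEquiv_ne {B W : Type*} [DecidableEq B] [Group W]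
    {M : CoxeterMatrix B} {cs : CoxeterSystem M W} {u : List B}
    (hw : IsFullyCommutative cs (cs.wordProd u)) (hu : cs.IsReduced u) (x y : List B) {s t : B}
    (hst : M s t = 3) : ¬ CommEquiv M u (x ++ s :: t :: s :: y) := by
  intro h
  have h1 := cs.simple_mul_simple_pow s t
  have h2 : cs.simple s * (cs.simple t * (cs.simple s * cs.wordProd y)) =
      cs.simple t * (cs.simple s * (cs.simple t * cs.wordProd y)) := by
    have h3 : (cs.simple s * cs.simple t) ^ 3 = (cs.simple s * cs.simple t * cs.simple s) *
        (cs.simple t * cs.simple s * cs.simple t) := by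
      simp only [pow_succ, pow_zero, one_mul, mul_assoc]
    rw [hst, h3, mul_eq_one_iff_eq_inv] at h1
    simp only [mul_inv_rev, cs.inv_simple] at h1
    simp only [← mul_assoc] at h1 ⊢
    rw [h1]
  have hst' : s ≠ t := by rintro rfl; simp at hst
  have h4 : cs.wordProd (x ++ t :: s :: t :: y) = cs.wordProd u := by
    rw [h.wordProd_eq cs]
    simp only [cs.wordProd_append, cs.wordProd_cons, h2]
  have h5 : cs.IsReduced (x ++ t :: s :: t :: y) := by
    rw [CoxeterSystem.IsReduced, h4, hu.eq, h.length_eq]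
    simp
  have h6 := (h.symm.trans (hw _ _ hu rfl h5 h4)).count_eq s
  simp [hst'.symm] at h6

theorem CoxeterSystem.IsReduced.commEquiv_ne {B W : Type*} [Group W]
    {M : CoxeterMatrix B} {cs : CoxeterSystem M W} {u : List B} (hu : cs.IsReduced u)
    (x y : List B) (s : B) : ¬ CommEquiv M u (x ++ s :: s :: y) := by
  intro h
  have h1 : cs.wordProd u = cs.wordProd (x ++ y) := by
    rw [h.wordProd_eq cs]
    simp [cs.wordProd_append, cs.wordProd_cons]
  have h2 := cs.length_wordProd_le (x ++ y)
  rw [← h1, hu.eq, h.length_eq] at h2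
  simp at h2

theorem mem_pairFilter_right {B : Type*} [DecidableEq B] {i j : B} {u : List B} :
    ∀ x ∈ pairFilter i j u, x = i ∨ x = j := fun _ hx => (mem_pairFilter.1 hx).2

theorem Alternating.reverse {B : Type*} [DecidableEq B] {M : CoxeterMatrix B} {u : List B}
    (hu : Alternating M u) :
    Alternating M u.reverse := fun i j hij => by
  rw [pairFilter, List.filter_reverse, List.isChain_reverse]
  exact (hu i j hij).imp fun _ _ h => h.symm

theorem sum_count_eq_length {B : Type*} [DecidableEq B] [Fintype B] (u : List B) :
    ∑ i, u.count i = u.length := by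
  simpa using Multiset.sum_count_eq_card (s := Finset.univ) (m := (u : Multiset B)) (by simp)

theorem affineA_symm {n : ℕ} (i j : Fin n) : affineA n i j = affineA n j i :=
  (affineA n).symmetric i j

theorem affineA_ne_of_eq_three {n : ℕ} {i j : Fin n} (h : affineA n i j = 3) : i ≠ j := by
  rintro rfl; simp at h

/-- Adjacent values differ by one or are both zero. -/
def IsProfile {n : ℕ} (c : Fin n → ℕ) : Prop :=
  ∀ i j, affineA n i j = 3 → c j = c i + 1 ∨ c i = c j + 1 ∨ (c i = 0 ∧ c j = 0)

theorem IsProfile.exists_alternating {n : ℕ} [NeZero n] (N : ℕ) :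
    ∀ c : Fin n → ℕ, ∑ i, c i = N → IsProfile c →
    ∃ u, Alternating (affineA n) u ∧ ∀ i, u.count i = c i := by
  induction N using Nat.strong_induction_on with
  | _ N ih =>
  intro c hN hc
  obtain ⟨i, hi⟩ := Finite.exists_max c
  rcases Nat.eq_zero_or_pos (c i) with h0 | hpos
  · exact ⟨[], fun _ _ _ => by simp, fun j => by have := hi j; simp; omega⟩
  have hnb : ∀ j, affineA n i j = 3 → c i = c j + 1 := fun j hj => by
    have := hc i j hj; have := hi j; omega
  have hc' : IsProfile (Function.update c i (c i - 2)) := by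
    intro p q hpq
    have hne := affineA_ne_of_eq_three hpq
    by_cases hp : p = i
    · subst hp
      have := hnb q hpq
      rw [Function.update_self, Function.update_of_ne hne.symm]
      omega
    by_cases hq : q = i
    · subst hq
      have := hnb p (by rwa [affineA_symm])
      rw [Function.update_self, Function.update_of_ne hne]
      omega
    · rw [Function.update_of_ne hp, Function.update_of_ne hq]
      exact hc p q hpq
  have hlt : ∑ j, Function.update c i (c i - 2) j < N := by
    rw [← hN]
    refine Finset.sum_lt_sum (fun j _ => ?_) ⟨i, Finset.mem_univ i, by simp; omega⟩
    by_cases hj : j = i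
    · subst hj; simp
    · simp [hj]
  obtain ⟨u, hu, hcount⟩ := ih _ hlt _ rfl hc'
  have hui : u.count i = c i - 2 := by simp [hcount]
  have huj : ∀ j, j ≠ i → u.count j = c j := fun j hj => by simp [hcount, hj]
  -- only edges at `i` have to be checked
  have reduce : ∀ v : List (Fin n), (∀ p q, p ≠ i → q ≠ i → pairFilter p q v = pairFilter p q u) →
      (∀ j, affineA n i j = 3 → (pairFilter i j v).IsChain (· ≠ ·)) →
      Alternating (affineA n) v := by
    intro v h1 h2 p q hpq
    by_cases hp : p = i
    · exact hp ▸ h2 q (hp ▸ hpq)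
    by_cases hq : q = i
    · rw [pairFilter_comm]
      exact hq ▸ h2 p (by rw [affineA_symm, ← hq]; exact hpq)
    · rw [h1 p q hp hq]; exact hu p q hpq
  by_cases h1 : c i = 1
  · refine ⟨i :: u, reduce _ (fun p q hp hq => ?_) fun j hj => ?_, fun j => ?_⟩
    · simp [pairFilter_cons, hp.symm, hq.symm]
    · have := hnb j hj
      have := huj j (affineA_ne_of_eq_three hj).symm
      rw [pairFilter_cons, if_pos (Or.inl rfl), pairFilter_eq_nil]
      · simp
      · rw [← List.count_eq_zero]; omega
      · rw [← List.count_eq_zero]; omega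
    · by_cases hj : j = i
      · subst hj; simp; omega
      · simp [huj j hj, Ne.symm hj]
  · refine ⟨i :: (u ++ [i]), reduce _ (fun p q hp hq => ?_) fun j hj => ?_, fun j => ?_⟩
    · simp [pairFilter_cons, hp.symm, hq.symm]
    · have h2 := hnb j hj
      have hne := affineA_ne_of_eq_three hj
      have h3 := huj j hne.symm
      have hlt' : (pairFilter i j u).count i < (pairFilter i j u).count j := by
        rw [count_pairFilter_left, count_pairFilter_right]; omega
      have hmem : ∀ x ∈ pairFilter i j u, x = j ∨ x = i :=
        fun x hx => (mem_pairFilter_right x hx).symm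
      have hhead := (hu i j hj).head?_eq hne.symm hmem hlt'
      have hlast := ((List.isChain_reverse (l := pairFilter i j u)).2
        ((hu i j hj).imp fun _ _ h => h.symm)).head?_eq hne.symm
          (fun x hx => hmem x (by simpa using hx)) (by simpa using hlt')
      rw [List.head?_reverse] at hlast
      have hchain : (pairFilter i j u ++ [i]).IsChain (· ≠ ·) := by
        refine List.isChain_append.2 ⟨hu i j hj, by simp, ?_⟩
        simp [hlast, hne.symm]
      rw [pairFilter_cons, if_pos (Or.inl rfl), pairFilter_append, pairFilter_cons,
        if_pos (Or.inl rfl), pairFilter_nil, List.isChain_cons]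
      refine ⟨?_, hchain⟩
      simp [List.head?_append, hhead, hne]
    · by_cases hj : j = i
      · subst hj; simp; omega
      · simp [huj j hj, Ne.symm hj]

variable {n : ℕ} [Fact (4 ≤ n)] [NeZero n]

theorem exists_other_neighbor {s t : Fin n} (h : affineA n s t = 3) :
    ∃ t', affineA n s t' = 3 ∧ ∀ a, a = s ∨ a = t ∨ a = t' ∨ affineA n a s = 2 := by
  have key : ∀ a, a = s ∨ a = s + 1 ∨ a = s - 1 ∨ affineA n a s = 2 := by
    intro a
    rcases affineA_eq_one_or_two_or_three a s with h | h | h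
    · exact Or.inl h
    · exact Or.inr (Or.inr (Or.inr h))
    · rcases affineA_eq_three_iff.1 h with rfl | rfl <;> simp
  rcases affineA_eq_three_iff.1 h with rfl | rfl
  · exact ⟨s - 1, affineA_sub_one s, key⟩
  · refine ⟨t + 1 + 1, affineA_add_one _, fun a => ?_⟩
    have := key a
    rw [add_sub_cancel_right] at this
    tauto

theorem not_eq_append_of_isReduced {u : List (Fin n)} (hu : (affineA n).toCoxeterSystem.IsReduced u)
    (hw : IsFullyCommutative (affineA n).toCoxeterSystem
      ((affineA n).toCoxeterSystem.wordProd u)) (N : ℕ) :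
    ∀ (x y z : List (Fin n)) (s t : Fin n), y.length = N → affineA n s t = 3 → s ∉ y → t ∉ y →
      u ≠ x ++ s :: (y ++ s :: z) := by
  induction N using Nat.strong_induction_on with
  | _ N ih =>
  rintro x y z s t hN hst hs ht rfl
  obtain ⟨t', ht', hall⟩ := exists_other_neighbor hst
  have hcomm : ∀ y' : List (Fin n), (∀ b ∈ y', b ∈ y) → t' ∉ y' → ∀ b ∈ y', affineA n b s = 2 := by
    intro y' hy' ht'' b hb
    rcases hall b with rfl | rfl | rfl | h
    · exact absurd (hy' b hb) hs
    · exact absurd (hy' b hb) ht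
    · exact absurd hb ht''
    · exact h
  by_cases h1 : t' ∈ y
  · obtain ⟨y₁, y₂, rfl, hy₁⟩ := List.eq_append_cons_of_mem h1
    by_cases h2 : t' ∈ y₂
    · obtain ⟨y₃, y₄, rfl, hy₃⟩ := List.eq_append_cons_of_mem h2
      refine ih y₃.length ?_ (x ++ s :: y₁) y₃ (y₄ ++ s :: z) t' s rfl (by rwa [affineA_symm])
        hy₃ (fun h => hs (by simp [h])) (by simp)
      rw [← hN]
      simp only [List.length_append, List.length_cons]
      omega
    · refine hw.commEquiv_ne hu (x ++ y₁) (y₂ ++ z) ht' ?_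
      have e1 := CommEquiv.move_front y₂ z (hcomm y₂ (by simp +contextual) h2)
      have e2 := CommEquiv.move_front y₁ (t' :: s :: (y₂ ++ z)) (hcomm y₁ (by simp +contextual) hy₁)
      have e3 := ((((e1.cons t').append_left y₁).cons s).trans e2.symm).append_left x
      simpa using e3
  · exact hu.commEquiv_ne x (y ++ z) s
      (((CommEquiv.move_front y z (hcomm y (fun _ h => h) h1)).cons s).append_left x)

theorem IsFullyCommutative.alternating {u : List (Fin n)}
    (hw : IsFullyCommutative (affineA n).toCoxeterSystem
      ((affineA n).toCoxeterSystem.wordProd u))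
    (hu : (affineA n).toCoxeterSystem.IsReduced u) : Alternating (affineA n) u := by
  intro i j hij
  by_contra h
  obtain ⟨x, s, y, z, rfl, h1, h2⟩ := List.exists_of_not_isChain_filter h
  have hi : i ∉ y := fun hi => h2 i hi (by simp)
  have hj : j ∉ y := fun hj => h2 j hj (by simp)
  simp only [decide_eq_true_eq] at h1
  rcases h1 with rfl | rfl
  · exact not_eq_append_of_isReduced hu hw _ x y z s j rfl hij hi hj rfl
  · exact not_eq_append_of_isReduced hu hw _ x y z s i rfl (by rwa [affineA_symm]) hj hi rfl

theorem Alternating.isReduced {u : List (Fin n)} (hu : Alternating (affineA n) u) :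
    (affineA n).toCoxeterSystem.IsReduced u := by
  obtain ⟨v, hv, hvu⟩ := (affineA n).toCoxeterSystem.exists_isReduced
    ((affineA n).toCoxeterSystem.wordProd u)
  have h := (hu.length_le_and_commEquiv _ v u rfl (wordPerm_eq_of_wordProd_eq hvu.symm)).1
  refine le_antisymm (CoxeterSystem.length_wordProd_le _ _) ?_
  rwa [hvu, hv.eq]

theorem Alternating.commEquiv_of_isReduced {u v : List (Fin n)} (hu : Alternating (affineA n) u)
    (hv : (affineA n).toCoxeterSystem.IsReduced v)
    (h : (affineA n).toCoxeterSystem.wordProd v = (affineA n).toCoxeterSystem.wordProd u) :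
    CommEquiv (affineA n) v u := by
  refine (hu.length_le_and_commEquiv _ v u rfl (wordPerm_eq_of_wordProd_eq h)).2 ?_
  rw [← hv.eq, ← hu.isReduced.eq, h]

theorem Alternating.isFullyCommutative {u : List (Fin n)} (hu : Alternating (affineA n) u) :
    IsFullyCommutative (affineA n).toCoxeterSystem
      ((affineA n).toCoxeterSystem.wordProd u) := fun _ _ hv hvu hw hwu =>
  (hu.commEquiv_of_isReduced hv hvu).trans (hu.commEquiv_of_isReduced hw hwu).symm

theorem Alternating.commEquiv_of_count_eq {u v : List (Fin n)} (hu : Alternating (affineA n) u)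
    (hv : Alternating (affineA n) v) (hp : IsProfile fun i => u.count i)
    (h : ∀ i, u.count i = v.count i) : CommEquiv (affineA n) u v := by
  have key : ∀ i j, affineA n i j = 3 → u.count j < u.count i →
      pairFilter i j u = pairFilter i j v := fun i j hij hlt =>
    (hu i j hij).eq_of_count_eq (affineA_ne_of_eq_three hij) (hv i j hij) mem_pairFilter_right
      mem_pairFilter_right (by rwa [count_pairFilter_left, count_pairFilter_right])
      (by rw [count_pairFilter_left, count_pairFilter_left, h])
      (by rw [count_pairFilter_right, count_pairFilter_right, h])
  refine commEquiv_of_pairFilter_eq fun i j hij => ?_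
  rcases affineA_eq_one_or_two_or_three i j with rfl | h2 | h3
  · have hrep : ∀ w : List (Fin n), pairFilter i i w = List.replicate (w.count i) i := by
      intro w
      have hmem : ∀ b ∈ pairFilter i i w, b = i := fun b hb => by
        simpa using mem_pairFilter_right b hb
      rw [List.eq_replicate_iff, ← count_pairFilter_left i i w]
      exact ⟨(List.count_eq_length.2 fun b hb => (hmem b hb).symm).symm, hmem⟩
    rw [hrep, hrep, h]
  · exact absurd h2 hij
  · rcases hp i j h3 with h4 | h4 | ⟨h4, h5⟩
    · rw [pairFilter_comm, pairFilter_comm i]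
      exact key j i (by rwa [affineA_symm]) (by simp only at h4; omega)
    · exact key i j h3 (by simp only at h4; omega)
    · have h4' := h i; have h5' := h j
      simp only at h4 h5
      rw [pairFilter_eq_nil (List.count_eq_zero.1 h4) (List.count_eq_zero.1 h5),
        pairFilter_eq_nil (List.count_eq_zero.1 (h4' ▸ h4)) (List.count_eq_zero.1 (h5' ▸ h5))]

theorem Alternating.mul_self_eq_one_iff {u : List (Fin n)} (hu : Alternating (affineA n) u) :
    (affineA n).toCoxeterSystem.wordProd u * (affineA n).toCoxeterSystem.wordProd u = 1 ↔
      IsProfile fun i => u.count i := by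
  constructor
  · intro h i j hij
    have h1 : CommEquiv (affineA n) u.reverse u :=
      hu.commEquiv_of_isReduced hu.reverse.isReduced
        (by rw [CoxeterSystem.wordProd_reverse, ← mul_eq_one_iff_inv_eq, h])
    have h2 := h1.pairFilter_eq (i := i) (j := j) (by omega)
    rw [pairFilter, List.filter_reverse] at h2
    have hne := affineA_ne_of_eq_three hij
    have h3 := ((hu i j hij).count_le_count_succ hne mem_pairFilter_right).2
    have h4 := ((hu i j hij).count_le_count_succ hne.symm
      fun x hx => (mem_pairFilter_right x hx).symm).2
    have h5 := (hu i j hij).count_ne_of_palindrome hne mem_pairFilter_right h2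
    rw [count_pairFilter_left, count_pairFilter_right] at h3 h4 h5
    by_cases h6 : pairFilter i j u = []
    · refine Or.inr (Or.inr ⟨?_, ?_⟩)
      · exact (count_pairFilter_left i j u).symm.trans (by rw [h6]; rfl)
      · exact (count_pairFilter_right i j u).symm.trans (by rw [h6]; rfl)
    · have := h5 h6
      simp only
      omega
  · intro hp
    have h := (hu.commEquiv_of_count_eq hu.reverse hp (by simp)).wordProd_eq
      (affineA n).toCoxeterSystem
    rw [CoxeterSystem.wordProd_reverse] at h
    exact mul_eq_one_iff_eq_inv.2 h

/-- Fully commutative involutions of given length are counted by profiles of given sum. -/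
theorem card_fcInvolution_eq_card_profile (L : ℕ) :
    Nat.card {w : (affineA n).Group // IsFCInvolution (affineA n).toCoxeterSystem w ∧
      (affineA n).toCoxeterSystem.length w = L} =
    Nat.card {c : Fin n → ℕ // IsProfile c ∧ ∑ i, c i = L} := by
  choose f hf hcount using fun c : {c : Fin n → ℕ // IsProfile c ∧ ∑ i, c i = L} =>
    IsProfile.exists_alternating _ c.1 rfl c.2.1
  have hfun : ∀ c, (fun i => (f c).count i) = c.1 := fun c => funext (hcount c)
  have hp : ∀ c, IsProfile fun i => (f c).count i := fun c => by rw [hfun]; exact c.2.1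
  have hlen : ∀ c, (affineA n).toCoxeterSystem.length
      ((affineA n).toCoxeterSystem.wordProd (f c)) = L := fun c => by
    rw [(hf c).isReduced.eq, ← sum_count_eq_length, ← c.2.2]
    exact Finset.sum_congr rfl fun i _ => hcount c i
  refine (Nat.card_congr (Equiv.ofBijective (fun c => ⟨(affineA n).toCoxeterSystem.wordProd (f c),
    ⟨(hf c).isFullyCommutative, (hf c).mul_self_eq_one_iff.2 (hp c)⟩, hlen c⟩) ⟨?_, ?_⟩)).symm
  · intro c c' h
    have h1 := (hf c').commEquiv_of_isReduced (hf c).isReduced (Subtype.ext_iff.1 h)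
    refine Subtype.ext (funext fun i => ?_)
    rw [← hcount, ← hcount, h1.count_eq]
  · rintro ⟨w, ⟨hw, hinv⟩, hlen⟩
    obtain ⟨u, hu, rfl⟩ := (affineA n).toCoxeterSystem.exists_isReduced w
    have hau := hw.alternating hu
    have hpu := hau.mul_self_eq_one_iff.1 hinv
    refine ⟨⟨fun i => u.count i, hpu, by rw [sum_count_eq_length, ← hlen, hu.eq]⟩, ?_⟩
    refine Subtype.ext (CommEquiv.wordProd_eq _ (CommEquiv.symm ?_))
    exact hau.commEquiv_of_count_eq (hf _) hpu fun i =>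
      (hcount ⟨fun i => u.count i, _⟩ i).symm

theorem IsProfile.add_natCast_le_and_sub_natCast_le {c : Fin n → ℕ} (hc : IsProfile c) {j : Fin n}
    (hj : c j = 0) (k : ℕ) : c (j + (k : Fin n)) ≤ k ∧ c (j - (k : Fin n)) ≤ k := by
  induction k with
  | zero => simp [hj]
  | succ k ih =>
    have h1 := hc _ _ (affineA_add_one (j + (k : Fin n)))
    have h2 := hc _ _ (affineA_sub_one (j - (k : Fin n)))
    rw [add_assoc] at h1
    rw [sub_sub] at h2
    rw [Nat.cast_succ]
    omega

theorem IsProfile.sum_le {c : Fin n → ℕ} (hc : IsProfile c) (hn : Even n) {j : Fin n}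
    (hj : c j = 0) : ∑ i, c i ≤ n ^ 2 / 4 := by
  obtain ⟨m, hm⟩ := hn
  have h1 : ∑ i, c i = ∑ k ∈ Finset.range n, c (j + (k : Fin n)) := by
    rw [← Fin.sum_univ_eq_sum_range fun k => c (j + (k : Fin n)), ← Equiv.sum_comp (Equiv.addLeft j)]
    simp
  have h2 : n ^ 2 / 4 = ∑ _k ∈ Finset.range m, m := by
    rw [hm, show (m + m) ^ 2 = m * m * 4 by ring, Nat.mul_div_cancel _ (by norm_num)]
    simp
  have h3 : Finset.range n = Finset.range (m + m) := by rw [← hm]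
  rw [h1, h2, h3, Finset.sum_range_add, ← Finset.sum_add_distrib]
  refine Finset.sum_le_sum fun k hk => ?_
  rw [Finset.mem_range] at hk
  have h4 := (hc.add_natCast_le_and_sub_natCast_le hj k).1
  have h5 := (hc.add_natCast_le_and_sub_natCast_le hj (m - k)).2
  have h6 : j + ((m + k : ℕ) : Fin n) = j - ((m - k : ℕ) : Fin n) := by
    rw [eq_sub_iff_add_eq, add_assoc, ← Nat.cast_add, show m + k + (m - k) = n by omega]
    simp
  rw [h6]
  omega

theorem card_profile_add (hn : Even n) {L : ℕ} (hL : 1 + n ^ 2 / 4 ≤ L) :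
    Nat.card {c : Fin n → ℕ // IsProfile c ∧ ∑ i, c i = L + n} =
      Nat.card {c : Fin n → ℕ // IsProfile c ∧ ∑ i, c i = L} := by
  have hpos : ∀ c : Fin n → ℕ, IsProfile c → L ≤ ∑ i, c i → ∀ i, 1 ≤ c i := fun c hc h i => by
    by_contra hi
    have := hc.sum_le hn (j := i) (by omega)
    omega
  have hsum : ∀ c : Fin n → ℕ, ∑ i, (c i + 1) = ∑ i, c i + n := fun c => by
    simp [Finset.sum_add_distrib]
  refine Nat.card_congr
    { toFun := fun c => ⟨fun i => c.1 i - 1, fun i j hij => ?_, ?_⟩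
      invFun := fun c => ⟨fun i => c.1 i + 1, fun i j hij => ?_, ?_⟩
      left_inv := fun c => ?_
      right_inv := fun c => ?_ }
  · have := c.2.1 i j hij
    have := hpos c.1 c.2.1 (by rw [c.2.2]; omega) i
    have := hpos c.1 c.2.1 (by rw [c.2.2]; omega) j
    simp only
    omega
  · have h := hsum fun i => c.1 i - 1
    have hc := hpos c.1 c.2.1 (by rw [c.2.2]; omega)
    simp only [Nat.sub_add_cancel (hc _), c.2.2] at h
    exact (Nat.add_right_cancel h).symm
  · have := c.2.1 i j hij
    have := hpos c.1 c.2.1 c.2.2.ge i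
    simp only
    omega
  · rw [hsum, c.2.2]
  · have hc := hpos c.1 c.2.1 (by rw [c.2.2]; omega)
    exact Subtype.ext (funext fun i => Nat.sub_add_cancel (hc i))
  · exact Subtype.ext (funext fun i => Nat.add_sub_cancel (c.1 i) 1)

end FullyCommutative

/-- For even `n ≥ 4`, the number `a(L)` of fully commutative involutions of Coxeter
length `L` in the affine Coxeter group of type `Ã_{n-1}` is periodic with period
dividing `n` from length `1 + n²/4` onwards: `a(L + n) = a(L)` for all `L ≥ 1 + n²/4`. -/
theorem periodic_fcInvolutions_affineA (n : ℕ) (hn : 4 ≤ n) (heven : Even n) :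
    ∀ L : ℕ, 1 + n ^ 2 / 4 ≤ L →
      Nat.card {w : (affineA n).Group //
        IsFCInvolution (affineA n).toCoxeterSystem w ∧
        (affineA n).toCoxeterSystem.length w = L + n} =
      Nat.card {w : (affineA n).Group //
        IsFCInvolution (affineA n).toCoxeterSystem w ∧
        (affineA n).toCoxeterSystem.length w = L} := by
  have : Fact (4 ≤ n) := ⟨hn⟩
  have : NeZero n := ⟨by omega⟩
  intro L hL
  rw [card_fcInvolution_eq_card_profile, card_fcInvolution_eq_card_profile,
    card_profile_add heven hL]
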